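/- arXiv:2002.04832 — 3 statements merged into one kernel-verified Lean document; each statement's English description precedes it below -/
import Mathlib

section
/- Let 𝒳 = ℝ^d, 𝒳_n = {x ∈ ℝ^d : |x| ≤ n}, and let Assumption (M) hold. Let g: [0,∞) → [0,∞) be non-decreasing with g(n) → ∞, set V(x) = g(|x|), and let (X_t) be a Markov chain with kernel Q such that sup_{k∈ℕ} E[V(X_k)] < ∞. Let μ* be the total-variation limit of L(X_t). Then for every n ∈ ℕ with g(n) > 0 and every t ∈ ℕ, ‖L(X_t) − μ*‖_TV ≤ 4 sup_{k∈ℕ} E[V(X_k)] / g(n) + 2(1 − α_n)^t. -/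
open MeasureTheory ProbabilityTheory Filter

/-- Total variation distance between two measures, defined as in the paper:
`‖μ − ν‖_TV = sup_{|φ|≤1} |∫ φ dμ − ∫ φ dν|`. -/
noncomputable def tvDist {X : Type*} [MeasurableSpace X] (μ ν : Measure X) : ℝ :=
  ⨆ φ : {φ : X → ℝ // Measurable φ ∧ ∀ x, |φ x| ≤ 1},
    |∫ x, φ.1 x ∂μ - ∫ x, φ.1 x ∂ν|

lemma abs_integral_le_of_abs_le {X : Type*} [MeasurableSpace X] (μ : Measure X)
    [IsProbabilityMeasure μ] {φ : X → ℝ} {c : ℝ} (hb : ∀ x, |φ x| ≤ c) :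
    |∫ x, φ x ∂μ| ≤ c := by
  simpa using norm_integral_le_of_norm_le_const (μ := μ) (f := φ) (C := c)
    (Eventually.of_forall hb)

lemma integrable_of_abs_le {X : Type*} [MeasurableSpace X] (μ : Measure X)
    [IsFiniteMeasure μ] {φ : X → ℝ} {c : ℝ} (hφ : Measurable φ) (hb : ∀ x, |φ x| ≤ c) :
    Integrable φ μ :=
  Integrable.of_bound hφ.aestronglyMeasurable c (Eventually.of_forall hb)

lemma abs_integral_sub_integral_le_two {X : Type*} [MeasurableSpace X] (μ ν : Measure X)
    [IsProbabilityMeasure μ] [IsProbabilityMeasure ν] {φ : X → ℝ} (hb : ∀ x, |φ x| ≤ 1) :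
    |∫ x, φ x ∂μ - ∫ x, φ x ∂ν| ≤ 2 := by
  have h₁ := abs_integral_le_of_abs_le μ hb
  have h₂ := abs_integral_le_of_abs_le ν hb
  rw [abs_le] at *
  constructor <;> linarith

instance nonempty_tvDist_test_functions {X : Type*} [MeasurableSpace X] :
    Nonempty {φ : X → ℝ // Measurable φ ∧ ∀ x, |φ x| ≤ 1} :=
  ⟨⟨fun _ => 0, measurable_const, by simp⟩⟩

lemma tvDist_le {X : Type*} [MeasurableSpace X] {μ ν : Measure X} {b : ℝ}
    (h : ∀ φ : X → ℝ, Measurable φ → (∀ x, |φ x| ≤ 1) →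
      |∫ x, φ x ∂μ - ∫ x, φ x ∂ν| ≤ b) : tvDist μ ν ≤ b :=
  ciSup_le fun φ => h φ.1 φ.2.1 φ.2.2

lemma tvDist_le_two {X : Type*} [MeasurableSpace X] (μ ν : Measure X)
    [IsProbabilityMeasure μ] [IsProbabilityMeasure ν] : tvDist μ ν ≤ 2 :=
  tvDist_le fun _ _ hb => abs_integral_sub_integral_le_two μ ν hb

lemma abs_integral_sub_integral_le_tvDist {X : Type*} [MeasurableSpace X] (μ ν : Measure X)
    [IsProbabilityMeasure μ] [IsProbabilityMeasure ν] {φ : X → ℝ} (hφ : Measurable φ)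
    (hb : ∀ x, |φ x| ≤ 1) : |∫ x, φ x ∂μ - ∫ x, φ x ∂ν| ≤ tvDist μ ν :=
  le_ciSup (f := fun φ : {φ : X → ℝ // Measurable φ ∧ ∀ x, |φ x| ≤ 1} =>
      |∫ x, φ.1 x ∂μ - ∫ x, φ.1 x ∂ν|)
    ⟨2, by rintro _ ⟨φ, rfl⟩; exact abs_integral_sub_integral_le_two μ ν φ.2.2⟩ ⟨φ, hφ, hb⟩

lemma abs_integral_sub_integral_le_mul_tvDist {X : Type*} [MeasurableSpace X]
    (μ ν : Measure X) [IsProbabilityMeasure μ] [IsProbabilityMeasure ν] {φ : X → ℝ}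
    (hφ : Measurable φ) {c : ℝ} (hc : 0 ≤ c) (hb : ∀ x, |φ x| ≤ c) :
    |∫ x, φ x ∂μ - ∫ x, φ x ∂ν| ≤ c * tvDist μ ν := by
  rcases hc.eq_or_lt with rfl | hc
  · have h0 : ∀ x, φ x = 0 := fun x => abs_nonpos_iff.1 (hb x)
    simp [h0]
  · have h := abs_integral_sub_integral_le_tvDist μ ν (φ := fun x => c⁻¹ * φ x)
      (hφ.const_mul _) (fun x => by
        rw [abs_mul, abs_of_pos (inv_pos.2 hc)]
        exact (inv_mul_le_one₀ hc).2 (hb x))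
    rwa [integral_const_mul, integral_const_mul, ← mul_sub, abs_mul,
      abs_of_pos (inv_pos.2 hc), inv_mul_le_iff₀ hc] at h

lemma tvDist_triangle {X : Type*} [MeasurableSpace X] (μ ν ρ : Measure X)
    [IsProbabilityMeasure μ] [IsProbabilityMeasure ν] [IsProbabilityMeasure ρ] :
    tvDist μ ρ ≤ tvDist μ ν + tvDist ν ρ :=
  tvDist_le fun _ hφ hb => (abs_sub_le _ _ _).trans
    (add_le_add (abs_integral_sub_integral_le_tvDist μ ν hφ hb)
      (abs_integral_sub_integral_le_tvDist ν ρ hφ hb))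

/-- If `κ` dominates `a • ν`, then integrals against `κ` of functions bounded by `1` are within
`1 - a` of the integrals against `a • ν`. -/
lemma abs_integral_sub_mul_integral_le {X : Type*} [MeasurableSpace X] (κ ν : Measure X)
    [IsProbabilityMeasure κ] [IsProbabilityMeasure ν] {a : ℝ} (ha : 0 ≤ a)
    (h : ∀ A, MeasurableSet A → ENNReal.ofReal a * ν A ≤ κ A) {φ : X → ℝ} (hφ : Measurable φ)
    (hb : ∀ x, |φ x| ≤ 1) : |∫ x, φ x ∂κ - a * ∫ x, φ x ∂ν| ≤ 1 - a := by
  have hle : ENNReal.ofReal a • ν ≤ κ := Measure.le_iff.2 fun A hA => by simpa using h A hA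
  have : IsFiniteMeasure (ENNReal.ofReal a • ν) := isFiniteMeasure_of_le κ hle
  have hres := Measure.sub_add_cancel_of_le hle
  set ρ := κ - ENNReal.ofReal a • ν
  have : IsFiniteMeasure ρ := isFiniteMeasure_of_le κ Measure.sub_le
  have hint : ∫ x, φ x ∂κ = ∫ x, φ x ∂ρ + a * ∫ x, φ x ∂ν := by
    rw [← hres, integral_add_measure (integrable_of_abs_le _ hφ hb)
      (integrable_of_abs_le _ hφ hb), integral_smul_measure, ENNReal.toReal_ofReal ha, smul_eq_mul]
  have hmass : ρ.real Set.univ = 1 - a := by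
    have h1 : (ρ + ENNReal.ofReal a • ν).real Set.univ = 1 := by rw [hres]; simp
    rw [measureReal_add_apply, measureReal_ennreal_smul_apply, ENNReal.toReal_ofReal ha,
      probReal_univ (μ := ν)] at h1
    linarith
  rw [hint, add_sub_cancel_right, ← hmass]
  simpa using norm_integral_le_of_norm_le_const (μ := ρ) (f := φ) (C := 1)
    (Eventually.of_forall hb)

/-- Contraction of the total variation distance under a kernel minorized on a set `B`. -/
lemma tvDist_bind_le {X : Type*} [MeasurableSpace X] (Q : Kernel X X) [IsMarkovKernel Q]
    (ν : Measure X) [IsProbabilityMeasure ν] {a : ℝ} (ha : 0 ≤ a) (ha1 : a ≤ 1)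
    {B : Set X} (hB : MeasurableSet B)
    (h : ∀ x ∈ B, ∀ A, MeasurableSet A → ENNReal.ofReal a * ν A ≤ Q x A)
    (μ₁ μ₂ : Measure X) [IsProbabilityMeasure μ₁] [IsProbabilityMeasure μ₂] :
    tvDist (μ₁.bind Q) (μ₂.bind Q) ≤
      (1 - a) * tvDist μ₁ μ₂ + 2 * a * (μ₁.real Bᶜ + μ₂.real Bᶜ) := by
  refine tvDist_le fun φ hφ hb => ?_
  set c := a * ∫ x, φ x ∂ν with hc
  have hcb : |c| ≤ a := by
    rw [hc, abs_mul, abs_of_nonneg ha]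
    exact mul_le_of_le_one_right ha (abs_integral_le_of_abs_le ν hb)
  set P : X → ℝ := fun x => ∫ y, φ y ∂(Q x)
  have hP : Measurable P := (hφ.stronglyMeasurable.integral_kernel (κ := Q)).measurable
  have hPb : ∀ x, |P x| ≤ 1 := fun x => abs_integral_le_of_abs_le _ hb
  have hPB : ∀ x ∈ B, |P x - c| ≤ 1 - a := fun x hx =>
    abs_integral_sub_mul_integral_le (Q x) ν ha (h x hx) hφ hb
  have hbind : ∀ μ : Measure X, IsProbabilityMeasure μ →
      ∫ x, φ x ∂(μ.bind Q) = ∫ x, P x ∂μ := fun μ _ => by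
    rw [Measure.comp_eq_comp_const_apply,
      Kernel.integral_comp (integrable_of_abs_le _ hφ hb), Kernel.const_apply]
  set T : X → ℝ := fun x => max (-(1 - a)) (min (1 - a) (P x - c))
  have hT : Measurable T := measurable_const.max (measurable_const.min (hP.sub_const c))
  have hTb : ∀ x, |T x| ≤ 1 - a := fun x =>
    abs_le.2 ⟨le_max_left _ _, max_le (by linarith) (min_le_left _ _)⟩
  have hdiff : ∀ x, |P x - c - T x| ≤ Bᶜ.indicator (fun _ => 2 * a) x := fun x => by
    by_cases hx : x ∈ B
    · obtain ⟨h1, h2⟩ := abs_le.1 (hPB x hx)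
      simp only [T, min_eq_right h2, max_eq_right h1]
      simp [hx]
    · have h1 := abs_le.1 (hPb x)
      have h2 := abs_le.1 hcb
      rw [Set.indicator_of_mem (by simpa using hx)]
      simp only [T]
      rw [abs_le]
      rcases le_total (1 - a) (P x - c) with h3 | h3
      · rw [min_eq_left h3, max_eq_right (by linarith)]
        constructor <;> linarith
      · rw [min_eq_right h3]
        rcases le_total (-(1 - a)) (P x - c) with h4 | h4
        · rw [max_eq_right h4]
          constructor <;> linarith
        · rw [max_eq_left h4]
          constructor <;> linarith
  have hest : ∀ μ : Measure X, IsProbabilityMeasure μ →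
      |∫ x, P x ∂μ - c - ∫ x, T x ∂μ| ≤ 2 * a * μ.real Bᶜ := fun μ _ => by
    have hPi := integrable_of_abs_le μ hP hPb
    have hTi := integrable_of_abs_le μ hT hTb
    have h1 : ∫ x, P x ∂μ - c - ∫ x, T x ∂μ = ∫ x, (P x - c - T x) ∂μ := by
      rw [integral_sub (f := fun x => P x - c) (hPi.sub (integrable_const c)) hTi,
        integral_sub hPi (integrable_const c)]
      simp
    rw [h1]
    calc |∫ x, (P x - c - T x) ∂μ| ≤ ∫ x, Bᶜ.indicator (fun _ => 2 * a) x ∂μ :=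
          (Real.norm_eq_abs _).symm.trans_le <|
            norm_integral_le_of_norm_le ((integrable_const _).indicator hB.compl)
              (Eventually.of_forall hdiff)
      _ = 2 * a * μ.real Bᶜ := by
          rw [integral_indicator_const _ hB.compl, smul_eq_mul, mul_comm]
  rw [hbind μ₁ inferInstance, hbind μ₂ inferInstance]
  have e1 := abs_le.1 (hest μ₁ inferInstance)
  have e2 := abs_le.1 (hest μ₂ inferInstance)
  have e3 := abs_le.1 (abs_integral_sub_integral_le_mul_tvDist μ₁ μ₂ hT (by linarith) hTb)
  rw [abs_le]
  constructor <;> linarith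

/-- Markov's inequality for a non-decreasing function of the norm. -/
lemma measureReal_compl_norm_le_le {E : Type*} [NormedAddCommGroup E] [MeasurableSpace E]
    [OpensMeasurableSpace E] (μ : Measure E) {g : ℝ → ℝ} (hg : MonotoneOn g (Set.Ici 0))
    {r : ℝ} (hr : 0 ≤ r) (hgr : 0 < g r) {C : ENNReal} (hC : C ≠ ⊤)
    (hμ : ∫⁻ x, ENNReal.ofReal (g ‖x‖) ∂μ ≤ C) :
    μ.real {x | ‖x‖ ≤ r}ᶜ ≤ C.toReal / g r := by
  have hB : MeasurableSet {x : E | ‖x‖ ≤ r}ᶜ :=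
    (measurableSet_le measurable_norm measurable_const).compl
  have h1 : ENNReal.ofReal (g r) * μ {x | ‖x‖ ≤ r}ᶜ ≤ C := by
    rw [← lintegral_indicator_const hB]
    refine (lintegral_mono fun x => ?_).trans hμ
    refine Set.indicator_apply_le' (fun hx => ?_) fun _ => bot_le
    have hx : r < ‖x‖ := by simpa using hx
    exact ENNReal.ofReal_le_ofReal (hg hr (norm_nonneg x) hx.le)
  have h2 := ENNReal.toReal_mono hC h1
  rw [ENNReal.toReal_mul, ENNReal.toReal_ofReal hgr.le] at h2
  rwa [le_div_iff₀ hgr, mul_comm]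

theorem tv_rate_estimate
    {d : ℕ}
    (Q : Kernel (EuclideanSpace ℝ (Fin d)) (EuclideanSpace ℝ (Fin d))) [IsMarkovKernel Q]
    -- Assumption (M) with 𝒳ₙ = {x : |x| ≤ n}
    (α : ℕ → ℝ) (hα : ∀ n, α n ∈ Set.Ioc (0:ℝ) 1) (hαanti : Antitone α)
    (ν : ℕ → Measure (EuclideanSpace ℝ (Fin d))) (hν : ∀ n, IsProbabilityMeasure (ν n))
    (hminor : ∀ n : ℕ, ∀ x : EuclideanSpace ℝ (Fin d), ‖x‖ ≤ n →
      ∀ A : Set (EuclideanSpace ℝ (Fin d)), MeasurableSet A →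
        ENNReal.ofReal (α n) * ν n A ≤ Q x A)
    -- V(x) = g(|x|) with g non-decreasing on [0,∞), g(n) → ∞
    (g : ℝ → ℝ) (hg0 : ∀ r : ℝ, 0 ≤ r → 0 ≤ g r) (hgmono : MonotoneOn g (Set.Ici 0))
    (hgtop : Tendsto (fun n : ℕ => g n) atTop atTop)
    -- (μ t): marginal laws of a Markov chain with kernel Q
    (μ : ℕ → Measure (EuclideanSpace ℝ (Fin d)))
    (hμprob : ∀ t, IsProbabilityMeasure (μ t))
    (hμchain : ∀ t, μ (t + 1) = (μ t).bind (fun x => Q x))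
    -- sup_k E[V(X_k)] < ∞
    (hVfin : (⨆ k, ∫⁻ x, ENNReal.ofReal (g ‖x‖) ∂(μ k)) ≠ ⊤)
    -- μ* is the total-variation limit of the laws
    (μstar : Measure (EuclideanSpace ℝ (Fin d))) (hμstar : IsProbabilityMeasure μstar)
    (hlim : Tendsto (fun t => tvDist (μ t) μstar) atTop (nhds 0)) :
    ∀ n t : ℕ, 0 < g n →
      tvDist (μ t) μstar ≤
        4 * (⨆ k, ∫⁻ x, ENNReal.ofReal (g ‖x‖) ∂(μ k)).toReal / g n
          + 2 * (1 - α n) ^ t := by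
  intro n t hgn
  set C := ⨆ k, ∫⁻ x, ENNReal.ofReal (g ‖x‖) ∂(μ k)
  have htail : ∀ k, (μ k).real {x | ‖x‖ ≤ n}ᶜ ≤ C.toReal / g n := fun k =>
    measureReal_compl_norm_le_le (μ k) hgmono (Nat.cast_nonneg n) hgn hVfin
      (le_iSup (fun k => ∫⁻ x, ENNReal.ofReal (g ‖x‖) ∂(μ k)) k)
  obtain ⟨ha0, ha1⟩ := hα n
  have hshift : ∀ t s, tvDist (μ t) (μ (t + s)) ≤
      4 * (C.toReal / g n) + 2 * (1 - α n) ^ t := by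
    intro t s
    induction t with
    | zero =>
      have h0 : 0 ≤ C.toReal / g n := by positivity
      have h2 := tvDist_le_two (μ 0) (μ (0 + s))
      rw [pow_zero]
      linarith
    | succ t ih =>
      have hstep := tvDist_bind_le Q (ν n) ha0.le ha1 (B := {x | ‖x‖ ≤ n})
        (measurableSet_le measurable_norm measurable_const) (hminor n) (μ t) (μ (t + s))
      rw [Nat.add_right_comm, hμchain t, hμchain (t + s)]
      refine hstep.trans ?_
      have h1 := mul_le_mul_of_nonneg_left ih (sub_nonneg.2 ha1)
      have h2 := mul_le_mul_of_nonneg_left (add_le_add (htail t) (htail (t + s)))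
        (by linarith : 0 ≤ 2 * α n)
      rw [pow_succ]
      linarith
  rw [mul_div_assoc]
  have hlim' : Tendsto (fun s => 4 * (C.toReal / g n) + 2 * (1 - α n) ^ t
      + tvDist (μ (t + s)) μstar) atTop
      (nhds (4 * (C.toReal / g n) + 2 * (1 - α n) ^ t + 0)) :=
    tendsto_const_nhds.add (hlim.comp (tendsto_atTop_mono (fun s => Nat.le_add_left s t) tendsto_id))
  rw [add_zero] at hlim'
  exact ge_of_tendsto' hlim' fun s =>
    (tvDist_triangle (μ t) (μ (t + s)) μstar).trans (add_le_add_left (hshift t s) _)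
end

section
/- Let Assumption (M') hold and let U = (U¹, U²) be uniformly distributed on [0,1]². For each n ∈ ℕ there exists a jointly measurable mapping Tⁿ: [0,1]² × 𝒳 × 𝒴 → 𝒳 such that (i) Q(x, y, A) = P(Tⁿ(U, x, y) ∈ A) for all x ∈ 𝒳, y ∈ 𝒴 and Borel A ⊆ 𝒳, and (ii) for every u₁ ∈ [0, α_n], every u₂ ∈ [0,1], every y ∈ 𝒴_n and all x₁, x₂ ∈ 𝒳_n, Tⁿ(u₁, u₂, x₁, y) = Tⁿ(u₁, u₂, x₂, y). -/
open MeasureTheory ProbabilityTheory Filter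

/-- A Markov kernel into a standard Borel space is jointly measurably driven by a real variable
which is uniformly distributed on `[0, 1]`. -/
lemma exists_measurable_map_restrict_Icc {X Y : Type*} [MeasurableSpace X] [MeasurableSpace Y]
    [Nonempty Y] [StandardBorelSpace Y] (κ : Kernel X Y) [IsMarkovKernel κ] :
    ∃ f : X × ℝ → Y, Measurable f ∧
      ∀ x, (volume.restrict (Set.Icc (0 : ℝ) 1)).map (fun t ↦ f (x, t)) = κ x := by
  obtain ⟨f, hf, hfκ⟩ := κ.exists_measurable_map_eq_unitInterval
  have hproj : Measurable (Set.projIcc (0 : ℝ) 1 zero_le_one) := continuous_projIcc.measurable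
  have hg : Measurable fun p : X × ℝ ↦ f p.1 (Set.projIcc (0 : ℝ) 1 zero_le_one p.2) :=
    hf.comp (measurable_fst.prodMk (hproj.comp measurable_snd))
  refine ⟨_, hg, fun x ↦ ?_⟩
  have hgx : Measurable fun t : ℝ ↦ f x (Set.projIcc (0 : ℝ) 1 zero_le_one t) :=
    hg.comp measurable_prodMk_left
  rw [← hfκ x, ← map_comap_subtype_coe measurableSet_Icc,
    Measure.map_map hgx measurable_subtype_coe]
  change Measure.map _ (volume : Measure unitInterval) = _
  congr 1
  funext t
  simp

/-- If a Markov kernel dominates `a • μ` on a measurable set `B`, it splits there as a mixture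
of `μ` and a residual Markov kernel, which may be taken to agree with it off `B`. -/
lemma exists_residual_kernel {X Y : Type*} [MeasurableSpace X] [MeasurableSpace Y]
    (κ : Kernel X Y) [IsMarkovKernel κ] (μ : Measure Y) [IsProbabilityMeasure μ]
    {B : Set X} (hB : MeasurableSet B) {a : ℝ} (ha : a ∈ Set.Ioc (0 : ℝ) 1)
    (hle : ∀ x ∈ B, ENNReal.ofReal a • μ ≤ κ x) :
    ∃ R : Kernel X Y, IsMarkovKernel R ∧
      (∀ x ∈ B, κ x = ENNReal.ofReal a • μ + ENNReal.ofReal (1 - a) • R x) ∧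
      ∀ x ∉ B, R x = κ x := by
  classical
  have hfin : IsFiniteMeasure (ENNReal.ofReal a • μ) := μ.smul_finite ENNReal.ofReal_ne_top
  have hsum : ENNReal.ofReal a + ENNReal.ofReal (1 - a) = 1 := by
    rw [← ENNReal.ofReal_add ha.1.le (sub_nonneg.2 ha.2)]
    simp
  rcases eq_or_lt_of_le ha.2 with rfl | ha1
  · refine ⟨κ, inferInstance, fun x hx ↦ ?_, fun _ _ ↦ rfl⟩
    have h := hle x hx
    simp only [ENNReal.ofReal_one, one_smul, sub_self, ENNReal.ofReal_zero, zero_smul,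
      add_zero] at h ⊢
    exact (Measure.eq_of_le_of_isProbabilityMeasure h).symm
  · have hc0 : ENNReal.ofReal (1 - a) ≠ 0 := by simpa using ha1
    have hc1 : ENNReal.ofReal (1 - a) ≠ ⊤ := ENNReal.ofReal_ne_top
    let R₀ : X → Measure Y := fun x ↦
      if x ∈ B then (ENNReal.ofReal (1 - a))⁻¹ • (κ x - ENNReal.ofReal a • μ) else κ x
    have hR₀ : Measurable R₀ := by
      refine Measure.measurable_of_measurable_coe _ fun s hs ↦ ?_
      have : (fun x ↦ R₀ x s) = fun x ↦ if x ∈ B then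
          (ENNReal.ofReal (1 - a))⁻¹ * (κ x s - ENNReal.ofReal a * μ s) else κ x s := by
        funext x
        by_cases hx : x ∈ B
        · simp [R₀, hx, Measure.sub_apply hs (hle x hx)]
        · simp [R₀, hx]
      rw [this]
      have hκ := κ.measurable_coe hs
      exact Measurable.ite hB ((hκ.sub_const _).const_mul _) hκ
    refine ⟨⟨R₀, hR₀⟩, ⟨fun x ↦ ⟨?_⟩⟩, fun x hx ↦ ?_, fun x hx ↦ ?_⟩
    · change R₀ x Set.univ = 1
      by_cases hx : x ∈ B
      · have : (1 : ENNReal) - ENNReal.ofReal a = ENNReal.ofReal (1 - a) := by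
          rw [← hsum]
          exact ENNReal.add_sub_cancel_left ENNReal.ofReal_ne_top
        simp [R₀, hx, Measure.sub_apply MeasurableSet.univ (hle x hx), this,
          ENNReal.inv_mul_cancel hc0 hc1]
      · simp [R₀, hx]
    · change κ x = _ + _ • R₀ x
      simp only [R₀, hx, if_true, smul_smul, ENNReal.mul_inv_cancel hc0 hc1, one_smul]
      rw [add_comm, Measure.sub_add_cancel_of_le (hle x hx)]
    · change R₀ x = κ x
      simp [R₀, hx]

/-- Selecting between two maps according to whether an independent uniform variable is at most `a`
produces the mixture with weights `a` and `1 - a` of the two laws. -/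
lemma map_prod_ite_le {Z Y : Type*} [MeasurableSpace Z] [MeasurableSpace Y]
    (μ : Measure Z) [SFinite μ] {f g : Z → Y} (hf : Measurable f) (hg : Measurable g)
    {a : ℝ} (ha : a ∈ Set.Ioc (0 : ℝ) 1) :
    ((volume.restrict (Set.Icc (0 : ℝ) 1)).prod μ).map (fun u ↦ if u.1 ≤ a then f u.2 else g u.2) =
      ENNReal.ofReal a • μ.map f + ENNReal.ofReal (1 - a) • μ.map g := by
  have hm : Measurable fun u : ℝ × Z ↦ if u.1 ≤ a then f u.2 else g u.2 :=
    Measurable.ite (measurableSet_le measurable_fst measurable_const)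
      (hf.comp measurable_snd) (hg.comp measurable_snd)
  have hlow : Set.Iic a ∩ Set.Icc (0 : ℝ) 1 = Set.Icc 0 a := by
    ext t
    simp only [Set.mem_inter_iff, Set.mem_Iic, Set.mem_Icc]
    exact ⟨fun h ↦ ⟨h.2.1, h.1⟩, fun h ↦ ⟨h.2, h.1, h.2.trans ha.2⟩⟩
  have hupp : Set.Ioi a ∩ Set.Icc (0 : ℝ) 1 = Set.Ioc a 1 := by
    ext t
    simp only [Set.mem_inter_iff, Set.mem_Ioi, Set.mem_Icc, Set.mem_Ioc]
    exact ⟨fun h ↦ ⟨h.1, h.2.2⟩, fun h ↦ ⟨h.1, (ha.1.trans h.1).le, h.2⟩⟩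
  ext s hs
  have hset : (fun u : ℝ × Z ↦ if u.1 ≤ a then f u.2 else g u.2) ⁻¹' s =
      Set.Iic a ×ˢ (f ⁻¹' s) ∪ Set.Ioi a ×ˢ (g ⁻¹' s) := by
    ext u
    by_cases hu : u.1 ≤ a
    · simp [hu]
    · simp [hu, not_le.1 hu]
  have hdisj : Disjoint (Set.Iic a ×ˢ (f ⁻¹' s)) (Set.Ioi a ×ˢ (g ⁻¹' s)) :=
    Set.disjoint_left.2 fun u h h' ↦ not_lt_of_ge (Set.mem_Iic.1 h.1) (Set.mem_Ioi.1 h'.1)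
  rw [Measure.map_apply hm hs, hset, measure_union hdisj (measurableSet_Ioi.prod (hg hs)),
    Measure.prod_prod, Measure.prod_prod, Measure.restrict_apply measurableSet_Iic,
    Measure.restrict_apply measurableSet_Ioi, hlow, hupp]
  simp [Measure.map_apply hf hs, Measure.map_apply hg hs]

theorem parametric_random_mapping_representation
    {𝒳 𝒴 : Type*} [MeasurableSpace 𝒳] [TopologicalSpace 𝒳] [PolishSpace 𝒳] [BorelSpace 𝒳]
    [MeasurableSpace 𝒴] [TopologicalSpace 𝒴] [PolishSpace 𝒴] [BorelSpace 𝒴]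
    -- parametrized family of transition kernels
    (Q : Kernel (𝒳 × 𝒴) 𝒳) [IsMarkovKernel Q]
    (Xs : ℕ → Set 𝒳) (hXsmeas : ∀ n, MeasurableSet (Xs n)) (hXsmono : Monotone Xs)
    (hXs0 : (Xs 0).Nonempty)
    (Ys : ℕ → Set 𝒴) (hYsmeas : ∀ n, MeasurableSet (Ys n)) (hYsmono : Monotone Ys)
    (hYs0 : (Ys 0).Nonempty)
    -- Assumption (M'): minorization on each 𝒳ₙ × 𝒴ₙ
    (α : ℕ → ℝ) (hα : ∀ n, α n ∈ Set.Ioc (0:ℝ) 1) (hαanti : Antitone α)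
    (ν : ℕ → Measure 𝒳) (hν : ∀ n, IsProbabilityMeasure (ν n))
    (hminor : ∀ n, ∀ x ∈ Xs n, ∀ y ∈ Ys n, ∀ A : Set 𝒳, MeasurableSet A →
      ENNReal.ofReal (α n) * ν n A ≤ Q (x, y) A)
    -- U = (U¹,U²) uniform on [0,1]²
    {Ω : Type*} [MeasurableSpace Ω] (P : Measure Ω) [IsProbabilityMeasure P]
    (U : Ω → ℝ × ℝ) (hU : Measurable U)
    (hUlaw : Measure.map U P =
      (volume.restrict (Set.Icc (0:ℝ) 1)).prod (volume.restrict (Set.Icc (0:ℝ) 1))) :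
    ∀ n : ℕ, ∃ T : (ℝ × ℝ) × 𝒳 × 𝒴 → 𝒳, Measurable T ∧
      (∀ x : 𝒳, ∀ y : 𝒴, ∀ A : Set 𝒳, MeasurableSet A →
        Q (x, y) A = P {ω | T (U ω, x, y) ∈ A}) ∧
      (∀ u₁ ∈ Set.Icc 0 (α n), ∀ u₂ ∈ Set.Icc (0:ℝ) 1, ∀ y ∈ Ys n,
        ∀ x₁ ∈ Xs n, ∀ x₂ ∈ Xs n, T ((u₁, u₂), x₁, y) = T ((u₁, u₂), x₂, y)) := by
  classical
  intro n
  have : Nonempty 𝒳 := ⟨hXs0.some⟩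
  have := hν n
  set B : Set (𝒳 × 𝒴) := Xs n ×ˢ Ys n
  have hB : MeasurableSet B := (hXsmeas n).prod (hYsmeas n)
  obtain ⟨R, hR, hQR, hRQ⟩ := exists_residual_kernel Q (ν n) hB (hα n) fun p hp ↦
    Measure.le_iff.2 fun A hA ↦ by simpa using hminor n p.1 hp.1 p.2 hp.2 A hA
  obtain ⟨f, hf, hfν⟩ := exists_measurable_map_restrict_Icc (Kernel.const Unit (ν n))
  obtain ⟨g, hg, hgR⟩ := exists_measurable_map_restrict_Icc R
  have hf' : Measurable fun t : ℝ ↦ f ((), t) := hf.comp measurable_prodMk_left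
  have hg' (p : 𝒳 × 𝒴) : Measurable fun t : ℝ ↦ g (p, t) := hg.comp measurable_prodMk_left
  let T : (ℝ × ℝ) × 𝒳 × 𝒴 → 𝒳 := fun q ↦
    if q.2 ∈ B ∧ q.1.1 ≤ α n then f ((), q.1.2) else g (q.2, q.1.2)
  have hT : Measurable T :=
    Measurable.ite ((measurable_snd hB).inter
        (measurableSet_le (measurable_fst.comp measurable_fst) measurable_const))
      (hf'.comp (measurable_snd.comp measurable_fst))
      (hg.comp (measurable_snd.prodMk (measurable_snd.comp measurable_fst)))
  refine ⟨T, hT, fun x y A hA ↦ ?_, fun u₁ hu₁ u₂ _ y hy x₁ hx₁ x₂ hx₂ ↦ ?_⟩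
  · have hTxy : Measurable fun u ↦ T (u, x, y) := hT.comp measurable_prodMk_right
    suffices h : Q (x, y) = ((volume.restrict (Set.Icc (0 : ℝ) 1)).prod
        (volume.restrict (Set.Icc (0 : ℝ) 1))).map fun u ↦ T (u, x, y) by
      rw [h, ← hUlaw, Measure.map_map hTxy hU, Measure.map_apply (hTxy.comp hU) hA]
      rfl
    by_cases hp : (x, y) ∈ B
    · have hTB : (fun u ↦ T (u, x, y)) =
          fun u ↦ if u.1 ≤ α n then f ((), u.2) else g ((x, y), u.2) := by
        funext u
        simp [T, hp]
      rw [hTB, map_prod_ite_le _ hf' (hg' (x, y)) (hα n), hfν, hgR, Kernel.const_apply]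
      exact hQR _ hp
    · have hTB : (fun u ↦ T (u, x, y)) = (fun t ↦ g ((x, y), t)) ∘ Prod.snd := by
        funext u
        simp [T, hp]
      rw [hTB, ← Measure.map_map (hg' (x, y)) measurable_snd, Measure.map_snd_prod]
      simp [hgR, hRQ _ hp]
  · have h₁ : (x₁, y) ∈ B := ⟨hx₁, hy⟩
    have h₂ : (x₂, y) ∈ B := ⟨hx₂, hy⟩
    simp [T, h₁, h₂, hu₁.2]
end

section
/- Let Assumption (M') hold, suppose P(Y_0 ∉ 𝒴_n) → 0 as n → ∞ and 𝔐_b ≠ ∅, and let μ♯ be the total-variation limit of L(X_t, (Y_{t+k})_{k∈ℤ}) for chains started in 𝔐_b. Then μ♯ is invariant in the following sense: if (X_t) is a Markov chain in the random environment (Y_t) with kernel Q such that L(X_0, (Y_k)_{k∈ℤ}) = μ♯, then L(X_t, (Y_{t+k})_{k∈ℤ}) = μ♯ for every t ∈ ℕ. -/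
open MeasureTheory ProbabilityTheory Filter

/-- `X` is a Markov chain in the random environment `Y` with kernel `Q`:
`P(X_{t+1} ∈ A | σ(Y_j, j ∈ ℤ; X_j, 0 ≤ j ≤ t)) = Q(X_t, Y_t, A)` a.s. -/
def IsMCRE {𝒳 𝒴 Ω : Type*} [MeasurableSpace 𝒳] [MeasurableSpace 𝒴] [MeasurableSpace Ω]
    (P : Measure Ω) (Q : Kernel (𝒳 × 𝒴) 𝒳) (Y : ℤ → Ω → 𝒴) (X : ℕ → Ω → 𝒳) : Prop :=
  ∀ t : ℕ, ∀ A : Set 𝒳, MeasurableSet A →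
    (P[fun ω => A.indicator (fun _ => (1:ℝ)) (X (t + 1) ω) |
        (⨆ j : ℤ, MeasurableSpace.comap (Y j) inferInstance) ⊔
          (⨆ j : Fin (t + 1), MeasurableSpace.comap (X j) inferInstance)])
      =ᵐ[P] fun ω => ((Q (X t ω, Y t ω)) A).toReal

/-- The one-step kernel of the chain together with its environment: move the first coordinate
with `Q` and shift the environment. -/
noncomputable def envShiftKernel {𝒳 𝒴 : Type*} [MeasurableSpace 𝒳] [MeasurableSpace 𝒴]
    (Q : Kernel (𝒳 × 𝒴) 𝒳) : Kernel (𝒳 × (ℤ → 𝒴)) (𝒳 × (ℤ → 𝒴)) :=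
  (Q.comap (fun p : 𝒳 × (ℤ → 𝒴) => (p.1, p.2 0)) (by fun_prop)) ×ₖ
    Kernel.deterministic (fun p : 𝒳 × (ℤ → 𝒴) => fun k : ℤ => p.2 (1 + k)) (by fun_prop)

instance {𝒳 𝒴 : Type*} [MeasurableSpace 𝒳] [MeasurableSpace 𝒴]
    (Q : Kernel (𝒳 × 𝒴) 𝒳) [IsMarkovKernel Q] : IsMarkovKernel (envShiftKernel Q) := by
  unfold envShiftKernel
  infer_instance

lemma IsMCRE.measure_inter_eq_lintegral {𝒳 𝒴 Ω : Type*} [MeasurableSpace 𝒳] [MeasurableSpace 𝒴]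
    [MeasurableSpace Ω] {P : Measure Ω} [IsProbabilityMeasure P] {Q : Kernel (𝒳 × 𝒴) 𝒳}
    [IsMarkovKernel Q] {Y : ℤ → Ω → 𝒴} {X : ℕ → Ω → 𝒳} (h : IsMCRE P Q Y X)
    (hY : ∀ j, Measurable (Y j)) (hX : ∀ t, Measurable (X t)) (t : ℕ) {A : Set 𝒳}
    (hA : MeasurableSet A) {S : Set Ω}
    (hS : MeasurableSet[⨆ j : ℤ, MeasurableSpace.comap (Y j) inferInstance] S) :
    P (X (t + 1) ⁻¹' A ∩ S) = ∫⁻ ω in S, Q (X t ω, Y t ω) A ∂P := by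
  have hm : (⨆ j : ℤ, MeasurableSpace.comap (Y j) inferInstance) ⊔
      (⨆ j : Fin (t + 1), MeasurableSpace.comap (X j) inferInstance) ≤ ‹MeasurableSpace Ω› :=
    sup_le (iSup_le fun j => (hY j).comap_le) (iSup_le fun j => (hX j).comap_le)
  have hSΩ : MeasurableSet S := hm _ (le_sup_left (α := MeasurableSpace Ω) _ hS)
  have hind : (fun ω => A.indicator (fun _ => (1 : ℝ)) (X (t + 1) ω))
      = (X (t + 1) ⁻¹' A).indicator (fun _ => (1 : ℝ)) := rfl
  have hint : Integrable (fun ω => A.indicator (fun _ => (1 : ℝ)) (X (t + 1) ω)) P := by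
    rw [hind]
    exact (integrable_const _).indicator (hX _ hA)
  have hcond := setIntegral_condExp hm hint (le_sup_left (α := MeasurableSpace Ω) _ hS)
  rw [setIntegral_congr_ae hSΩ ((h t A hA).mono fun _ hω _ => hω), hind,
    integral_indicator_const _ (hX _ hA), smul_eq_mul, mul_one, measureReal_def,
    Measure.restrict_apply (hX _ hA), integral_toReal] at hcond
  · refine ((ENNReal.toReal_eq_toReal_iff' ?_ (measure_ne_top _ _)).1 hcond).symm
    refine ((lintegral_mono fun ω => prob_le_one).trans_lt ?_).ne
    simp
  · exact ((Q.measurable_coe hA).comp ((hX t).prodMk (hY t))).aemeasurable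
  · exact ae_of_all _ fun ω => measure_lt_top _ _

lemma IsMCRE.map_succ_eq_bind {𝒳 𝒴 Ω : Type*} [MeasurableSpace 𝒳] [MeasurableSpace 𝒴]
    [MeasurableSpace Ω] {P : Measure Ω} [IsProbabilityMeasure P] {Q : Kernel (𝒳 × 𝒴) 𝒳}
    [IsMarkovKernel Q] {Y : ℤ → Ω → 𝒴} {X : ℕ → Ω → 𝒳} (h : IsMCRE P Q Y X)
    (hY : ∀ j, Measurable (Y j)) (hX : ∀ t, Measurable (X t)) (t : ℕ) :
    P.map (fun ω => (X (t + 1) ω, fun k : ℤ => Y (((t + 1 : ℕ) : ℤ) + k) ω))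
      = (P.map (fun ω => (X t ω, fun k : ℤ => Y ((t : ℤ) + k) ω))).bind (envShiftKernel Q) := by
  have hmeas : ∀ s : ℕ, Measurable (fun ω => (X s ω, fun k : ℤ => Y ((s : ℤ) + k) ω)) :=
    fun s => (hX s).prodMk (measurable_pi_lambda _ fun k => hY _)
  have hprob := Measure.isProbabilityMeasure_map (μ := P) (hmeas (t + 1)).aemeasurable
  refine Measure.ext_prod fun {A B} hA hB => ?_
  have hS : MeasurableSet[⨆ j : ℤ, MeasurableSpace.comap (Y j) inferInstance]
      ((fun ω => fun k : ℤ => Y (((t + 1 : ℕ) : ℤ) + k) ω) ⁻¹' B) := by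
    refine @measurable_pi_lambda _ _ _ (_) _ _ (fun k => ?_) _ hB
    exact Measurable.mono (comap_measurable _) (le_iSup (fun j : ℤ =>
      MeasurableSpace.comap (Y j) inferInstance) _) le_rfl
  have hSΩ : MeasurableSet ((fun ω => fun k : ℤ => Y (((t + 1 : ℕ) : ℤ) + k) ω) ⁻¹' B) :=
    (measurable_pi_lambda _ fun k => hY _) hB
  rw [Measure.map_apply (hmeas _) (hA.prod hB), Measure.bind_apply (hA.prod hB)
    (Kernel.aemeasurable _), lintegral_map (Kernel.measurable_coe _ (hA.prod hB)) (hmeas t)]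
  refine (h.measure_inter_eq_lintegral hY hX t hA hS).trans ?_
  rw [← lintegral_indicator hSΩ]
  refine lintegral_congr fun ω => ?_
  rw [envShiftKernel, Kernel.prod_apply_prod, Kernel.comap_apply,
    Kernel.deterministic_apply' _ _ hB]
  have hshift : (fun k : ℤ => Y (((t + 1 : ℕ) : ℤ) + k) ω)
      = fun k : ℤ => Y ((t : ℤ) + (1 + k)) ω := by
    simp only [Nat.cast_add, Nat.cast_one, add_assoc]
  by_cases hω : (fun k : ℤ => Y ((t : ℤ) + (1 + k)) ω) ∈ B <;>
    simp only [Set.indicator, Set.mem_preimage, hshift, hω, if_true, if_false, add_zero, mul_one,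
      mul_zero]

lemma abs_integral_sub_le_tvDist {E : Type*} [MeasurableSpace E] (μ ν : Measure E)
    [IsProbabilityMeasure μ] [IsProbabilityMeasure ν] {φ : E → ℝ} (hφ : Measurable φ)
    (hb : ∀ x, |φ x| ≤ 1) : |∫ x, φ x ∂μ - ∫ x, φ x ∂ν| ≤ tvDist μ ν := by
  have hle : ∀ (ρ : Measure E) [IsProbabilityMeasure ρ] (ψ : E → ℝ), (∀ x, |ψ x| ≤ 1) →
      |∫ x, ψ x ∂ρ| ≤ 1 := fun ρ _ ψ hψ => by
    simpa using norm_integral_le_of_norm_le_const (μ := ρ) (f := ψ) (C := 1) (ae_of_all _ hψ)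
  refine le_ciSup (f := fun φ : {φ : E → ℝ // Measurable φ ∧ ∀ x, |φ x| ≤ 1} =>
    |∫ x, φ.1 x ∂μ - ∫ x, φ.1 x ∂ν|) ⟨1 + 1, ?_⟩ ⟨φ, hφ, hb⟩
  rintro _ ⟨ψ, rfl⟩
  exact (abs_sub _ _).trans (add_le_add (hle μ _ ψ.2.2) (hle ν _ ψ.2.2))

lemma tendsto_integral_of_tendsto_tvDist {E : Type*} [MeasurableSpace E] {μ : ℕ → Measure E}
    {ν : Measure E} [∀ t, IsProbabilityMeasure (μ t)] [IsProbabilityMeasure ν]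
    (h : Tendsto (fun t => tvDist (μ t) ν) atTop (nhds 0)) {φ : E → ℝ} (hφ : Measurable φ)
    (hb : ∀ x, |φ x| ≤ 1) : Tendsto (fun t => ∫ x, φ x ∂μ t) atTop (nhds (∫ x, φ x ∂ν)) :=
  tendsto_iff_dist_tendsto_zero.2 <| squeeze_zero (fun _ => dist_nonneg)
    (fun t => abs_integral_sub_le_tvDist (μ t) ν hφ hb) h

/-- A total variation limit of the iterates of a Markov kernel is invariant. -/
lemma bind_eq_self_of_tendsto_tvDist {E : Type*} [MeasurableSpace E] {μ : ℕ → Measure E}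
    {ν : Measure E} [∀ t, IsProbabilityMeasure (μ t)] [IsProbabilityMeasure ν]
    (K : Kernel E E) [IsMarkovKernel K] (hK : ∀ t, μ (t + 1) = (μ t).bind K)
    (h : Tendsto (fun t => tvDist (μ t) ν) atTop (nhds 0)) : ν.bind K = ν := by
  ext A hA
  have hreal : ∀ ρ : Measure E, ∫ x, (K x A).toReal ∂ρ = (ρ.bind K A).toReal := fun ρ => by
    rw [Measure.bind_apply hA K.aemeasurable, integral_toReal
      (K.measurable_coe hA).aemeasurable (ae_of_all _ fun x => measure_lt_top _ _)]
  have hstep := tendsto_integral_of_tendsto_tvDist h (φ := fun x => (K x A).toReal)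
    (K.measurable_coe hA).ennreal_toReal fun x => by
      rw [abs_of_nonneg ENNReal.toReal_nonneg]
      exact measureReal_le_one
  simp only [hreal, ← hK] at hstep
  have hset := tendsto_integral_of_tendsto_tvDist h (φ := A.indicator 1)
    (measurable_one.indicator hA) fun x => by by_cases hx : x ∈ A <;> simp [hx]
  simp only [integral_indicator_one hA, measureReal_def] at hset
  exact (ENNReal.toReal_eq_toReal_iff' (measure_ne_top _ _) (measure_ne_top _ _)).1
    (tendsto_nhds_unique hstep (hset.comp (tendsto_add_atTop_nat 1)))

/-- The limiting law `μ♯` is invariant: if a Markov chain `X'` in the random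
environment `Y` is started from `L(X'_0, (Y_k)) = μ♯` then
`L(X'_t, (Y_{t+k})) = μ♯` for every `t`.  The chain `X`, started in `𝔐_b`
and whose shifted laws converge to `μ♯` in total variation, identifies `μ♯`
as the limit from Theorem 2 (and witnesses `𝔐_b ≠ ∅`). -/
theorem mcre_limit_invariant
    {𝒳 𝒴 : Type*} [MeasurableSpace 𝒳] [TopologicalSpace 𝒳] [PolishSpace 𝒳] [BorelSpace 𝒳]
    [MeasurableSpace 𝒴] [TopologicalSpace 𝒴] [PolishSpace 𝒴] [BorelSpace 𝒴]
    {Ω : Type*} [MeasurableSpace Ω] (P : Measure Ω) [IsProbabilityMeasure P]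
    -- stationary environment
    (Y : ℤ → Ω → 𝒴) (hYmeas : ∀ j, Measurable (Y j))
    (hYstat : ∀ k : ℤ, Measure.map (fun ω => fun j : ℤ => Y (j + k) ω) P
      = Measure.map (fun ω => fun j : ℤ => Y j ω) P)
    -- parametrized family of transition kernels
    (Q : Kernel (𝒳 × 𝒴) 𝒳) [IsMarkovKernel Q]
    (Xs : ℕ → Set 𝒳) (hXsmeas : ∀ n, MeasurableSet (Xs n)) (hXsmono : Monotone Xs)
    (hXs0 : (Xs 0).Nonempty)
    (Ys : ℕ → Set 𝒴) (hYsmeas : ∀ n, MeasurableSet (Ys n)) (hYsmono : Monotone Ys)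
    (hYs0 : (Ys 0).Nonempty)
    -- Assumption (M')
    (α : ℕ → ℝ) (hα : ∀ n, α n ∈ Set.Ioc (0:ℝ) 1) (hαanti : Antitone α)
    (ν : ℕ → Measure 𝒳) (hν : ∀ n, IsProbabilityMeasure (ν n))
    (hminor : ∀ n, ∀ x ∈ Xs n, ∀ y ∈ Ys n, ∀ A : Set 𝒳, MeasurableSet A →
      ENNReal.ofReal (α n) * ν n A ≤ Q (x, y) A)
    -- P(Y₀ ∉ 𝒴ₙ) → 0
    (hY0 : Tendsto (fun n => P {ω | Y 0 ω ∉ Ys n}) atTop (nhds 0))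
    -- a chain started in 𝔐_b whose shifted laws converge to μ♯ (so 𝔐_b ≠ ∅
    -- and μ♯ is the total-variation limit from the convergence theorem)
    (X : ℕ → Ω → 𝒳) (hXmeas : ∀ t, Measurable (X t)) (hmcre : IsMCRE P Q Y X)
    (htight : Tendsto (fun n => ⨆ t, P {ω | X t ω ∉ Xs n}) atTop (nhds 0))
    (μsharp : Measure (𝒳 × (ℤ → 𝒴))) (hμsharp : IsProbabilityMeasure μsharp)
    (hlim : Tendsto (fun t : ℕ =>
        tvDist (Measure.map (fun ω => (X t ω, fun k : ℤ => Y ((t : ℤ) + k) ω)) P) μsharp)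
      atTop (nhds 0))
    -- a chain started from μ♯
    (X' : ℕ → Ω → 𝒳) (hX'meas : ∀ t, Measurable (X' t)) (hmcre' : IsMCRE P Q Y X')
    (hinit : Measure.map (fun ω => (X' 0 ω, fun k : ℤ => Y k ω)) P = μsharp) :
    ∀ t : ℕ, Measure.map (fun ω => (X' t ω, fun k : ℤ => Y ((t : ℤ) + k) ω)) P = μsharp := by
  have hprob : ∀ t : ℕ, IsProbabilityMeasure
      (P.map (fun ω => (X t ω, fun k : ℤ => Y ((t : ℤ) + k) ω))) := fun t =>
    Measure.isProbabilityMeasure_map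
      ((hXmeas t).prodMk (measurable_pi_lambda _ fun k => hYmeas _)).aemeasurable
  have hinv := bind_eq_self_of_tendsto_tvDist (envShiftKernel Q)
    (hmcre.map_succ_eq_bind hYmeas hXmeas) hlim
  intro t
  induction t with
  | zero => simpa using hinit
  | succ t ih => rw [hmcre'.map_succ_eq_bind hYmeas hX'meas, ih, hinv]
end
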